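/- Let E be a real inner product space, F : E → ℝ, L > 0, and Gf : E → E a map satisfying the smoothness (descent) inequality: for all u, v ∈ E, F(u) ≤ F(v) + ⟪Gf(v), u − v⟫ + (L/2)·‖u − v‖². Fix w ∈ E, a finite index set S, weights α : S → ℝ with α_k ≥ 0 and ∑_{k∈S} α_k ≤ 1, vectors g : S → E and constants δ : S → ℝ with ‖Gf(w) − g_k‖ ≤ δ_k for all k ∈ S, and a step size η with 0 < η and L·η < 1. Let (Ω, μ) be a probability space and Z : Ω → E a random vector with ∫ Z dμ = 0 and ∫ ‖Z‖² dμ = σ₀², such that Z, ‖Z‖², and ω ↦ F(w − η·(∑_{k∈S} α_k g_k) − η·Z(ω)) are integrable. Then ∫ F(w − η·(∑_{k∈S} α_k g_k) − η·Z(ω)) dμ − F(w) ≤ −(η/2)·(∑_{k∈S} α_k)·‖Gf(w)‖² − ((η − L·η²)/2)·∑_{k∈S} α_k·(‖g_k‖² − (η/(η − L·η²))·δ_k²) + (L·η²/2)·σ₀². -/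

import Mathlib

open MeasureTheory
open scoped RealInnerProductSpace

/-- One-step convergence bound (Lemma 1): expected loss reduction for the noisy
weighted-aggregation update. -/
theorem stmt_0 {E : Type*} [NormedAddCommGroup E] [InnerProductSpace ℝ E] [CompleteSpace E]
    {Ω : Type*} {mΩ : MeasurableSpace Ω} (μ : Measure Ω) [IsProbabilityMeasure μ]
    (F : E → ℝ) (L : ℝ) (hL : 0 < L) (Gf : E → E)
    (hsmooth : ∀ u v : E, F u ≤ F v + ⟪Gf v, u - v⟫ + L / 2 * ‖u - v‖ ^ 2)
    (w : E) {ι : Type*} (S : Finset ι) (α : ι → ℝ)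
    (hα0 : ∀ k ∈ S, 0 ≤ α k) (hα1 : ∑ k ∈ S, α k ≤ 1)
    (g : ι → E) (δ : ι → ℝ) (hδ : ∀ k ∈ S, ‖Gf w - g k‖ ≤ δ k)
    (η : ℝ) (hη : 0 < η) (hLη : L * η < 1)
    (Z : Ω → E) (σ0sq : ℝ)
    (hZint : Integrable Z μ) (hZmean : ∫ ω, Z ω ∂μ = 0)
    (hZsq : Integrable (fun ω => ‖Z ω‖ ^ 2) μ)
    (hZvar : ∫ ω, ‖Z ω‖ ^ 2 ∂μ = σ0sq)
    (hFint : Integrable (fun ω => F (w - η • (∑ k ∈ S, α k • g k) - η • Z ω)) μ) :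
    (∫ ω, F (w - η • (∑ k ∈ S, α k • g k) - η • Z ω) ∂μ) - F w ≤
      -(η / 2) * (∑ k ∈ S, α k) * ‖Gf w‖ ^ 2
        - (η - L * η ^ 2) / 2 *
            ∑ k ∈ S, α k * (‖g k‖ ^ 2 - η / (η - L * η ^ 2) * δ k ^ 2)
        + L * η ^ 2 / 2 * σ0sq := by
  have hD : 0 < η - L * η ^ 2 := by nlinarith
  set G : E := ∑ k ∈ S, α k • g k with hG
  -- inner products with the aggregate
  have hin : ∀ x : E, ⟪x, G⟫ = ∑ k ∈ S, α k * ⟪x, g k⟫ := by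
    intro x
    rw [hG, inner_sum]
    exact Finset.sum_congr rfl fun k _ => by rw [real_inner_smul_right]
  -- Jensen
  have hJ : ‖G‖ ^ 2 ≤ ∑ k ∈ S, α k * ‖g k‖ ^ 2 := by
    have h0 : 0 ≤ ∑ k ∈ S, α k * ‖G - g k‖ ^ 2 :=
      Finset.sum_nonneg fun k hk => mul_nonneg (hα0 k hk) (sq_nonneg _)
    have h1 : ∑ k ∈ S, α k * ‖G - g k‖ ^ 2
        = (∑ k ∈ S, α k) * ‖G‖ ^ 2 - 2 * ⟪G, G⟫ + ∑ k ∈ S, α k * ‖g k‖ ^ 2 := by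
      rw [hin G, Finset.sum_mul, Finset.mul_sum, ← Finset.sum_sub_distrib,
        ← Finset.sum_add_distrib]
      exact Finset.sum_congr rfl fun k _ => by rw [norm_sub_sq_real]; ring
    rw [h1, real_inner_self_eq_norm_sq] at h0
    nlinarith [mul_le_mul_of_nonneg_right hα1 (sq_nonneg ‖G‖)]
  -- cross term
  have hC : -⟪Gf w, G⟫ ≤ ∑ k ∈ S, α k * ((δ k ^ 2 - ‖Gf w‖ ^ 2 - ‖g k‖ ^ 2) / 2) := by
    rw [hin, ← Finset.sum_neg_distrib]
    refine Finset.sum_le_sum fun k hk => ?_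
    rw [← mul_neg]
    refine mul_le_mul_of_nonneg_left ?_ (hα0 k hk)
    have h1 := norm_sub_sq_real (Gf w) (g k)
    have h2 := pow_le_pow_left₀ (norm_nonneg _) (hδ k hk) 2
    linarith
  have hC' : ∑ k ∈ S, α k * ((δ k ^ 2 - ‖Gf w‖ ^ 2 - ‖g k‖ ^ 2) / 2)
      = (∑ k ∈ S, α k * δ k ^ 2) / 2 - (∑ k ∈ S, α k) * ‖Gf w‖ ^ 2 / 2
        - (∑ k ∈ S, α k * ‖g k‖ ^ 2) / 2 := by
    rw [Finset.sum_mul, Finset.sum_div, Finset.sum_div, Finset.sum_div,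
      ← Finset.sum_sub_distrib, ← Finset.sum_sub_distrib]
    exact Finset.sum_congr rfl fun k _ => by ring
  have hR : (η - L * η ^ 2) / 2 *
            ∑ k ∈ S, α k * (‖g k‖ ^ 2 - η / (η - L * η ^ 2) * δ k ^ 2)
      = (η - L * η ^ 2) / 2 * (∑ k ∈ S, α k * ‖g k‖ ^ 2)
        - η / 2 * ∑ k ∈ S, α k * δ k ^ 2 := by
    rw [Finset.mul_sum, Finset.mul_sum, Finset.mul_sum, ← Finset.sum_sub_distrib]
    refine Finset.sum_congr rfl fun k _ => ?_
    have hh : (η - L * η ^ 2) * (η / (η - L * η ^ 2)) = η := mul_div_cancel₀ _ hD.ne'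
    linear_combination (-(α k * δ k ^ 2) / 2) * hh
  -- pointwise bound
  have hP : ∀ ω, F (w - η • G - η • Z ω) ≤
      (F w - η * ⟪Gf w, G⟫ + L * η ^ 2 / 2 * ‖G‖ ^ 2)
        + ⟪(L * η ^ 2) • G - η • Gf w, Z ω⟫ + L * η ^ 2 / 2 * ‖Z ω‖ ^ 2 := by
    intro ω
    refine (hsmooth _ w).trans (le_of_eq ?_)
    have e : w - η • G - η • Z ω - w = -(η • (G + Z ω)) := by
      rw [smul_add]; abel
    rw [e, norm_neg, norm_smul, mul_pow, norm_add_sq_real, Real.norm_eq_abs, sq_abs,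
      inner_neg_right, real_inner_smul_right, inner_add_right, inner_sub_left,
      real_inner_smul_left, real_inner_smul_left]
    ring
  have hI1 : Integrable (fun ω => ⟪(L * η ^ 2) • G - η • Gf w, Z ω⟫) μ :=
    hZint.const_inner _
  have hI0 : ∫ ω, ⟪(L * η ^ 2) • G - η • Gf w, Z ω⟫ ∂μ = 0 := by
    rw [integral_inner hZint, hZmean, inner_zero_right]
  have hI2 := hZsq.const_mul (L * η ^ 2 / 2)
  have hIc : Integrable (fun _ : Ω => F w - η * ⟪Gf w, G⟫ + L * η ^ 2 / 2 * ‖G‖ ^ 2) μ :=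
    integrable_const _
  have hM := integral_mono hFint ((hIc.add hI1).add hI2) hP
  have hE : ∫ ω, ((F w - η * ⟪Gf w, G⟫ + L * η ^ 2 / 2 * ‖G‖ ^ 2)
        + ⟪(L * η ^ 2) • G - η • Gf w, Z ω⟫ + L * η ^ 2 / 2 * ‖Z ω‖ ^ 2) ∂μ
      = F w - η * ⟪Gf w, G⟫ + L * η ^ 2 / 2 * ‖G‖ ^ 2 + L * η ^ 2 / 2 * σ0sq := by
    refine (integral_add (hIc.add hI1) hI2).trans ?_
    rw [integral_add' hIc hI1, hI0, integral_const_mul, hZvar]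
    simp
  have hM' := hM.trans_eq hE
  rw [hC'] at hC
  rw [hR]
  have h3 := mul_le_mul_of_nonneg_left hC hη.le
  have h4 := mul_le_mul_of_nonneg_left hJ (by positivity : 0 ≤ L * η ^ 2 / 2)
  linarith
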